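/- The adaptive Euler–Maruyama scheme has the following flow (cocycle) property: for every initial value y ∈ ℝ^d, every continuous path w : [0,∞) → ℝ^d with w(0) = 0, and every k ∈ ℕ₀, writing Φ(y,w) for the scheme path driven by w, τ_k(y,w) for its k-th grid point, and θ_s w := (w(s+t) − w(s))_{t≥0} for the shifted driver, one has Φ(y,w)(t + τ_k(y,w)) = Φ( Φ(y,w)(τ_k(y,w)), θ_{τ_k(y,w)} w )(t) for all t ≥ 0. In particular, for the scheme driven by a Brownian motion W, (X^h_{t+τ_k})_{t≥0} = Φ( X^h_{τ_k}, W^{τ_k} ) where W^{τ_k}_t = W_{t+τ_k} − W_{τ_k}. -/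

import Mathlib

open MeasureTheory
open scoped ENNReal NNReal

/-- The deterministic adaptive Euler–Maruyama path map: for every initial value `y` and
every continuous driver `w` with `w 0 = 0`, `Φ y w` is the scheme path and `𝒯 y w k` its
`k`-th grid point, defined by `𝒯 y w 0 = 0`, `Φ y w 0 = y`,
`𝒯 y w (k+1) = 𝒯 y w k + g (Φ y w (𝒯 y w k))` and the Euler step in between. -/
structure IsSchemeMap {d : ℕ}
    (μ : EuclideanSpace ℝ (Fin d) → EuclideanSpace ℝ (Fin d))
    (σ : EuclideanSpace ℝ (Fin d) → EuclideanSpace ℝ (Fin d) →L[ℝ] EuclideanSpace ℝ (Fin d))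
    (g : EuclideanSpace ℝ (Fin d) → ℝ)
    (Φ : EuclideanSpace ℝ (Fin d) → (ℝ → EuclideanSpace ℝ (Fin d)) → ℝ → EuclideanSpace ℝ (Fin d))
    (𝒯 : EuclideanSpace ℝ (Fin d) → (ℝ → EuclideanSpace ℝ (Fin d)) → ℕ → ℝ) : Prop where
  grid_zero : ∀ y w, w 0 = 0 → Continuous w → 𝒯 y w 0 = 0
  init : ∀ y w, w 0 = 0 → Continuous w → Φ y w 0 = y
  grid_succ : ∀ y w, w 0 = 0 → Continuous w → ∀ k : ℕ,
    𝒯 y w (k + 1) = 𝒯 y w k + g (Φ y w (𝒯 y w k))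
  step : ∀ y w, w 0 = 0 → Continuous w → ∀ k : ℕ,
    ∀ t ∈ Set.Icc (𝒯 y w k) (𝒯 y w (k + 1)),
      Φ y w t = Φ y w (𝒯 y w k) + (t - 𝒯 y w k) • μ (Φ y w (𝒯 y w k))
        + σ (Φ y w (𝒯 y w k)) (w t - w (𝒯 y w k))

namespace IsSchemeMap

variable {d : ℕ}
  {μ : EuclideanSpace ℝ (Fin d) → EuclideanSpace ℝ (Fin d)}
  {σ : EuclideanSpace ℝ (Fin d) → EuclideanSpace ℝ (Fin d) →L[ℝ] EuclideanSpace ℝ (Fin d)}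
  {g : EuclideanSpace ℝ (Fin d) → ℝ}
  {Φ : EuclideanSpace ℝ (Fin d) → (ℝ → EuclideanSpace ℝ (Fin d)) → ℝ → EuclideanSpace ℝ (Fin d)}
  {𝒯 : EuclideanSpace ℝ (Fin d) → (ℝ → EuclideanSpace ℝ (Fin d)) → ℕ → ℝ}

/-- If the step size is bounded below by a positive constant, the grid intervals cover
`[0, ∞)`. -/
theorem exists_mem_Icc_grid (hΦ : IsSchemeMap μ σ g Φ 𝒯) {c : ℝ} (hc : 0 < c)
    (hg : ∀ y, c ≤ g y) (y : EuclideanSpace ℝ (Fin d)) {w : ℝ → EuclideanSpace ℝ (Fin d)}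
    (hw0 : w 0 = 0) (hw : Continuous w) {t : ℝ} (ht : 0 ≤ t) :
    ∃ n, t ∈ Set.Icc (𝒯 y w n) (𝒯 y w (n + 1)) := by
  have lower (n : ℕ) : n * c ≤ 𝒯 y w n := by
    induction n with
    | zero => simp [hΦ.grid_zero y w hw0 hw]
    | succ n ih =>
      rw [hΦ.grid_succ y w hw0 hw]
      push_cast
      linarith [hg (Φ y w (𝒯 y w n))]
  by_contra! hcover
  have below (n : ℕ) : 𝒯 y w n ≤ t := by
    induction n with
    | zero => rwa [hΦ.grid_zero y w hw0 hw]
    | succ n ih => exact not_lt.mp fun h => hcover n ⟨ih, h.le⟩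
  obtain ⟨n, hn⟩ := exists_nat_gt (t / c)
  exact ((div_lt_iff₀ hc).mp hn).not_ge ((lower n).trans (below n))

/-- If a grid point of the path restarted at time `T` matches a grid point of the original path,
then the two paths agree up to the next grid point. -/
theorem apply_add_eq_of_mem_Icc (hΦ : IsSchemeMap μ σ g Φ 𝒯)
    {y z : EuclideanSpace ℝ (Fin d)} {w : ℝ → EuclideanSpace ℝ (Fin d)} {T : ℝ}
    (hw0 : w 0 = 0) (hw : Continuous w) {m n : ℕ}
    (hgrid : 𝒯 y w m = 𝒯 z (fun s => w (s + T) - w T) n + T)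
    (hpath : Φ y w (𝒯 y w m)
      = Φ z (fun s => w (s + T) - w T) (𝒯 z (fun s => w (s + T) - w T) n))
    {t : ℝ} (ht : t ∈ Set.Icc (𝒯 z (fun s => w (s + T) - w T) n)
      (𝒯 z (fun s => w (s + T) - w T) (n + 1))) :
    Φ y w (t + T) = Φ z (fun s => w (s + T) - w T) t := by
  have hv0 : (fun s => w (s + T) - w T) 0 = 0 := by simp
  have hv : Continuous fun s => w (s + T) - w T := by fun_prop
  have ht' : t + T ∈ Set.Icc (𝒯 y w m) (𝒯 y w (m + 1)) := by
    have hsucc := hΦ.grid_succ z _ hv0 hv n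
    rw [hΦ.grid_succ y w hw0 hw, hpath, hgrid]
    constructor <;> linarith [ht.1, ht.2]
  rw [hΦ.step y w hw0 hw m _ ht', hΦ.step z _ hv0 hv n t ht, hpath, hgrid]
  simp only [add_sub_add_right_eq_sub, sub_sub_sub_cancel_right]

/-- The grid of the path restarted at the `k`-th grid point is the shifted original grid, and the
paths agree on it. -/
theorem grid_add (hΦ : IsSchemeMap μ σ g Φ 𝒯) (hg : ∀ y, 0 ≤ g y)
    (y : EuclideanSpace ℝ (Fin d)) {w : ℝ → EuclideanSpace ℝ (Fin d)}
    (hw0 : w 0 = 0) (hw : Continuous w) (k n : ℕ) {T : ℝ} (hT : 𝒯 y w k = T)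
    {z : EuclideanSpace ℝ (Fin d)} (hz : Φ y w T = z) :
    𝒯 y w (k + n) = 𝒯 z (fun s => w (s + T) - w T) n + T ∧
      Φ y w (𝒯 y w (k + n))
        = Φ z (fun s => w (s + T) - w T) (𝒯 z (fun s => w (s + T) - w T) n) := by
  have hv0 : (fun s => w (s + T) - w T) 0 = 0 := by simp
  have hv : Continuous fun s => w (s + T) - w T := by fun_prop
  induction n with
  | zero => simp [hΦ.grid_zero z _ hv0 hv, hΦ.init z _ hv0 hv, hT, hz]
  | succ n ih =>
    obtain ⟨hgrid, hpath⟩ := ih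
    have hsucc := hΦ.grid_succ z _ hv0 hv n
    have hgrid' : 𝒯 y w (k + (n + 1)) = 𝒯 z (fun s => w (s + T) - w T) (n + 1) + T := by
      rw [← add_assoc, hΦ.grid_succ y w hw0 hw, hpath, hgrid, hsucc]
      ring
    refine ⟨hgrid', ?_⟩
    rw [hgrid']
    refine hΦ.apply_add_eq_of_mem_Icc hw0 hw hgrid hpath ⟨?_, le_rfl⟩
    rw [hsucc]
    exact le_add_of_nonneg_right (hg _)

/-- The flow property of the adaptive Euler–Maruyama scheme. -/
theorem apply_add_grid (hΦ : IsSchemeMap μ σ g Φ 𝒯) {c : ℝ} (hc : 0 < c) (hg : ∀ y, c ≤ g y)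
    (y : EuclideanSpace ℝ (Fin d)) {w : ℝ → EuclideanSpace ℝ (Fin d)}
    (hw0 : w 0 = 0) (hw : Continuous w) (k : ℕ) {t : ℝ} (ht : 0 ≤ t) :
    Φ y w (t + 𝒯 y w k)
      = Φ (Φ y w (𝒯 y w k)) (fun s => w (s + 𝒯 y w k) - w (𝒯 y w k)) t := by
  obtain ⟨n, hn⟩ := hΦ.exists_mem_Icc_grid hc hg (Φ y w (𝒯 y w k))
    (w := fun s => w (s + 𝒯 y w k) - w (𝒯 y w k)) (by simp) (by fun_prop) ht
  obtain ⟨hgrid, hpath⟩ := hΦ.grid_add (fun y => hc.le.trans (hg y)) y hw0 hw k n rfl rfl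
  exact hΦ.apply_add_eq_of_mem_Icc hw0 hw hgrid hpath hn

end IsSchemeMap

/-- Flow (cocycle) property of the adaptive Euler–Maruyama scheme:
`Φ(y,w)(t + τ_k(y,w)) = Φ(Φ(y,w)(τ_k(y,w)), θ_{τ_k(y,w)} w)(t)` for all `t ≥ 0`;
in particular, for the scheme driven by a (pathwise continuous, vanishing at `0`)
process `W`, `(X^h_{t+τ_k})_{t ≥ 0} = Φ(X^h_{τ_k}, W^{τ_k})`. -/
theorem stmt8 {d : ℕ}
    (μ : EuclideanSpace ℝ (Fin d) → EuclideanSpace ℝ (Fin d))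
    (σ : EuclideanSpace ℝ (Fin d) → EuclideanSpace ℝ (Fin d) →L[ℝ] EuclideanSpace ℝ (Fin d))
    (δ : ℝ) (hδ0 : 0 < δ) (hδ1 : δ < 1)
    (g : EuclideanSpace ℝ (Fin d) → ℝ) (hgb : ∀ y, δ ^ 2 ≤ g y ∧ g y ≤ δ)
    (Φ : EuclideanSpace ℝ (Fin d) → (ℝ → EuclideanSpace ℝ (Fin d)) → ℝ →
      EuclideanSpace ℝ (Fin d))
    (𝒯 : EuclideanSpace ℝ (Fin d) → (ℝ → EuclideanSpace ℝ (Fin d)) → ℕ → ℝ)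
    (hΦ : IsSchemeMap μ σ g Φ 𝒯) :
    (∀ (y : EuclideanSpace ℝ (Fin d)) (w : ℝ → EuclideanSpace ℝ (Fin d)),
      w 0 = 0 → Continuous w → ∀ (k : ℕ) (t : ℝ), 0 ≤ t →
        Φ y w (t + 𝒯 y w k)
          = Φ (Φ y w (𝒯 y w k)) (fun s => w (s + 𝒯 y w k) - w (𝒯 y w k)) t) ∧
    ∀ (Ω : Type) (W : ℝ → Ω → EuclideanSpace ℝ (Fin d)) (x : EuclideanSpace ℝ (Fin d))
      (ω : Ω), W 0 ω = 0 → Continuous (fun s => W s ω) →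
      ∀ (k : ℕ) (t : ℝ), 0 ≤ t →
        Φ x (fun s => W s ω) (t + 𝒯 x (fun s => W s ω) k)
          = Φ (Φ x (fun s => W s ω) (𝒯 x (fun s => W s ω) k))
              (fun s => W (s + 𝒯 x (fun s => W s ω) k) ω
                - W (𝒯 x (fun s => W s ω) k) ω) t := by
  have flow := fun y w (hw0 : w 0 = 0) (hw : Continuous w) k t (ht : 0 ≤ t) =>
    hΦ.apply_add_grid (pow_pos hδ0 2) (fun y => (hgb y).1) y hw0 hw k ht
  exact ⟨flow, fun _ W x ω => flow x fun s => W s ω⟩
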